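/- Let p be a prime and q = p^m. If there exists an F_q-linear [[n,k,r,d]]_q subsystem code with k > 1 that is pure to d', then there exists an F_q-linear [[n, k−1, r+1, d_m]]_q subsystem code with d_m ≥ d that is pure to min{d, d'}. If a pure F_q-linear [[n,1,r,d]]_q subsystem code exists, then there exists an F_q-linear [[n,0,r+1,d]]_q subsystem code. -/

import Mathlib

open scoped BigOperators

/-- The symplectic weight of a vector `(x|y) ∈ F_q^n × F_q^n`: the number of
coordinates `i` with `(x_i, y_i) ≠ (0,0)`. -/
noncomputable def swt {F : Type*} [Field F] {n : ℕ} (v : (Fin n → F) × (Fin n → F)) : ℕ :=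
  Nat.card {i : Fin n // ¬(v.1 i = 0 ∧ v.2 i = 0)}

/-- The minimum symplectic weight of the nonzero elements of a set `X`. -/
noncomputable def minSwt {F : Type*} [Field F] {n : ℕ}
    (X : Set ((Fin n → F) × (Fin n → F))) : ℕ :=
  sInf (swt '' {v ∈ X | v ≠ 0})

/-- The trace-symplectic form `⟨(a|b)|(a'|b')⟩ₛ = Tr_{F_q/F_p}(a'·b − a·b')`. -/
noncomputable def traceSymp (p : ℕ) {F : Type*} [Field F] [Algebra (ZMod p) F] {n : ℕ}
    (u w : (Fin n → F) × (Fin n → F)) : ZMod p :=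
  Algebra.trace (ZMod p) F (∑ i, (w.1 i * u.2 i - u.1 i * w.2 i))

/-- The trace-symplectic dual of a set `C ⊆ F_q^{2n}`. -/
def sdual (p : ℕ) {F : Type*} [Field F] [Algebra (ZMod p) F] {n : ℕ}
    (C : Set ((Fin n → F) × (Fin n → F))) : Set ((Fin n → F) × (Fin n → F)) :=
  {v | ∀ w ∈ C, traceSymp p v w = 0}

/-- `C` is (the additive code associated with) an `((n,K,R,d))_q` Clifford subsystem code:
with `D = C ∩ C^⊥s`, `|C| = q^n R / K`, `|D| = q^n/(KR)`, and `d = swt(D^⊥s − C)` if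
`C ≠ D^⊥s`, else `d = swt(D^⊥s)`. -/
def IsSubsysCode (p : ℕ) {F : Type*} [Field F] [Fintype F] [Algebra (ZMod p) F] {n : ℕ}
    (K R d : ℕ) (C : AddSubgroup ((Fin n → F) × (Fin n → F))) : Prop :=
  let S : Set ((Fin n → F) × (Fin n → F)) := ↑C
  let D : Set ((Fin n → F) × (Fin n → F)) := S ∩ sdual p S
  let Dp : Set ((Fin n → F) × (Fin n → F)) := sdual p D
  K * Nat.card C = Fintype.card F ^ n * R ∧
  K * R * Nat.card D = Fintype.card F ^ n ∧
  (S = Dp → d = minSwt Dp) ∧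
  (S ≠ Dp → d = minSwt (Dp \ S))

/-- `C` is (the linear code associated with) an `F_q`-linear `[[n,k,r,d]]_q` subsystem code. -/
def IsLinSubsysCode (p : ℕ) {F : Type*} [Field F] [Fintype F] [Algebra (ZMod p) F] {n : ℕ}
    (k r d : ℕ) (C : Submodule F ((Fin n → F) × (Fin n → F))) : Prop :=
  IsSubsysCode p (Fintype.card F ^ k) (Fintype.card F ^ r) d C.toAddSubgroup

open Module LinearMap.BilinForm

/-- The radical of `C` is unchanged when `C` is enlarged by a hyperbolic pair orthogonal to it. -/
lemma exists_le_finrank_add_two_inf_orthogonal_eq {K V : Type*} [Field K] [AddCommGroup V]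
    [Module K V] [FiniteDimensional K V] {B : LinearMap.BilinForm K V} (hB : B.Nondegenerate)
    (hA : B.IsAlt) {C : Submodule K V} (hC : ¬ B.orthogonal C ≤ C) :
    ∃ C' : Submodule K V, C ≤ C' ∧ finrank K C' = finrank K C + 2 ∧
      C' ⊓ B.orthogonal C' = C ⊓ B.orthogonal C := by
  have hR : B.IsRefl := hA.isRefl
  obtain ⟨x, hx, hxC⟩ := SetLike.not_le_iff_exists.1 hC
  obtain ⟨z, hz, hzx⟩ : ∃ z ∈ B.orthogonal C, B z x ≠ 0 := by
    by_contra! h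
    exact hxC (orthogonal_orthogonal hB hR C ▸ mem_orthogonal_iff.2 h)
  have hxz : B x z ≠ 0 := fun h => hzx (hR _ _ h)
  have hxx : B x x = 0 := hA x
  have hzz : B z z = 0 := hA z
  have hx' : ∀ c ∈ C, B c x = 0 := mem_orthogonal_iff.1 hx
  have hz' : ∀ c ∈ C, B c z = 0 := mem_orthogonal_iff.1 hz
  let f : C × K × K →ₗ[K] V := C.subtype.coprod
    ((LinearMap.toSpanSingleton K V x).coprod (LinearMap.toSpanSingleton K V z))
  have hf : ∀ c a b, f (c, a, b) = c + (a • x + b • z) := fun c a b => by simp [f]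
  have hfx : ∀ c a b, B (f (c, a, b)) x = b * B z x := fun c a b => by
    simp [hf, hx' c c.2, hxx]
  have hfz : ∀ c a b, B (f (c, a, b)) z = a * B x z := fun c a b => by
    simp [hf, hz' c c.2, hzz]
  have hxf : x ∈ LinearMap.range f := ⟨(0, 1, 0), by simp [hf]⟩
  have hzf : z ∈ LinearMap.range f := ⟨(0, 0, 1), by simp [hf]⟩
  have hCf : C ≤ LinearMap.range f := fun c hc => ⟨(⟨c, hc⟩, 0, 0), by simp [hf]⟩
  have hinj : Function.Injective f := by
    rw [← LinearMap.ker_eq_bot, LinearMap.ker_eq_bot']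
    rintro ⟨c, a, b⟩ h
    have hb : b = 0 := by simpa [h, hzx] using hfx c a b
    have ha : a = 0 := by simpa [h, hxz] using hfz c a b
    subst ha hb
    simpa [hf] using h
  refine ⟨LinearMap.range f, hCf, ?_, le_antisymm ?_ ?_⟩
  · rw [LinearMap.finrank_range_of_inj hinj]
    simp
  · rintro _ ⟨⟨⟨c, a, b⟩, rfl⟩, hv⟩
    have hv' := mem_orthogonal_iff.1 hv
    have hb : b = 0 := by simpa [hzx] using (hfx c a b).symm.trans (hR _ _ (hv' x hxf))
    have ha : a = 0 := by simpa [hxz] using (hfz c a b).symm.trans (hR _ _ (hv' z hzf))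
    subst ha hb
    exact ⟨by simp [hf], mem_orthogonal_iff.2 fun w hw => hv' w (hCf hw)⟩
  · rintro v ⟨hvC, hv⟩
    refine ⟨hCf hvC, mem_orthogonal_iff.2 ?_⟩
    rintro _ ⟨⟨c, a, b⟩, rfl⟩
    have h1 : B c v = 0 := mem_orthogonal_iff.1 hv c c.2
    have h2 : B x v = 0 := hR _ _ (hx' v hvC)
    have h3 : B z v = 0 := hR _ _ (hz' v hvC)
    simp [hf, h1, h2, h3]

section Symplectic

variable {F : Type*} [Field F] {n : ℕ}

/-- The symplectic bilinear form whose trace is `traceSymp`. -/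
def sympForm (F : Type*) [Field F] (n : ℕ) :
    LinearMap.BilinForm F ((Fin n → F) × (Fin n → F)) :=
  LinearMap.mk₂ F (fun u w => ∑ i, (w.1 i * u.2 i - u.1 i * w.2 i))
    (fun _ _ _ => by
      rw [← Finset.sum_add_distrib]
      exact Finset.sum_congr rfl fun _ _ => by simp; ring)
    (fun _ _ _ => by
      rw [smul_eq_mul, Finset.mul_sum]
      exact Finset.sum_congr rfl fun _ _ => by simp; ring)
    (fun _ _ _ => by
      rw [← Finset.sum_add_distrib]
      exact Finset.sum_congr rfl fun _ _ => by simp; ring)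
    (fun _ _ _ => by
      rw [smul_eq_mul, Finset.mul_sum]
      exact Finset.sum_congr rfl fun _ _ => by simp; ring)

lemma sympForm_apply (u w : (Fin n → F) × (Fin n → F)) :
    sympForm F n u w = ∑ i, (w.1 i * u.2 i - u.1 i * w.2 i) := rfl

lemma sympForm_isAlt : (sympForm F n).IsAlt := fun u => by
  rw [sympForm_apply]
  exact Finset.sum_eq_zero fun i _ => sub_self _

lemma sympForm_nondegenerate : (sympForm F n).Nondegenerate := by
  refine (LinearMap.IsRefl.nondegenerate_iff_separatingLeft (B := sympForm F n)
    sympForm_isAlt.isRefl).2 ?_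
  intro u hu
  ext i
  · simpa [sympForm_apply, Pi.single_apply] using hu (0, Pi.single i 1)
  · simpa [sympForm_apply, Pi.single_apply] using hu (Pi.single i 1, 0)

lemma sdual_coe (p : ℕ) [Fact p.Prime] [Finite F] [Algebra (ZMod p) F]
    (C : Submodule F ((Fin n → F) × (Fin n → F))) :
    sdual p (C : Set ((Fin n → F) × (Fin n → F))) = (sympForm F n).orthogonal C := by
  ext v
  rw [SetLike.mem_coe, mem_orthogonal_iff]
  refine ⟨fun hv w hw => sympForm_isAlt.isRefl _ _ ?_, fun hv w hw => ?_⟩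
  · by_contra h
    obtain ⟨t, ht⟩ := Algebra.trace_surjective (ZMod p) F 1
    have := hv ((t / sympForm F n v w) • w) (C.smul_mem _ hw)
    rw [traceSymp, ← sympForm_apply, map_smul, smul_eq_mul, div_mul_cancel₀ _ h, ht] at this
    exact one_ne_zero this
  · rw [traceSymp, ← sympForm_apply, sympForm_isAlt.isRefl _ _ (hv w hw), map_zero]

lemma finrank_orthogonal_sympForm_add (C : Submodule F ((Fin n → F) × (Fin n → F))) :
    finrank F ((sympForm F n).orthogonal C) + finrank F C = 2 * n := by
  have h := finrank_orthogonal sympForm_nondegenerate C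
  have h' := Submodule.finrank_le C
  simp only [finrank_prod, finrank_fin_fun] at h h'
  omega

lemma le_orthogonal_inf_orthogonal (C : Submodule F ((Fin n → F) × (Fin n → F))) :
    C ≤ (sympForm F n).orthogonal (C ⊓ (sympForm F n).orthogonal C) :=
  fun v hv => mem_orthogonal_iff.2 fun _ hw =>
    sympForm_isAlt.isRefl _ _ (mem_orthogonal_iff.1 hw.2 v hv)

/-- A dimension-theoretic description of `[[n,k,r,d]]_q` codes; the code equals the dual of its
radical exactly when `k = 0`. -/
lemma isLinSubsysCode_iff {p : ℕ} [Fact p.Prime] [Fintype F] [Algebra (ZMod p) F] {k r d : ℕ}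
    {C : Submodule F ((Fin n → F) × (Fin n → F))} :
    IsLinSubsysCode p k r d C ↔
      k + finrank F C = n + r ∧
      k + r + finrank F (C ⊓ (sympForm F n).orthogonal C : Submodule F _) = n ∧
      let Dp : Submodule F ((Fin n → F) × (Fin n → F)) :=
        (sympForm F n).orthogonal (C ⊓ (sympForm F n).orthogonal C)
      (k = 0 → C = Dp ∧ d = minSwt (Dp : Set ((Fin n → F) × (Fin n → F)))) ∧
      (k ≠ 0 → d = minSwt ((Dp : Set ((Fin n → F) × (Fin n → F))) \ C)) := by
  have hcard (W : Submodule F ((Fin n → F) × (Fin n → F))) :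
      Nat.card W = Fintype.card F ^ finrank F W := by
    rw [Module.natCard_eq_pow_finrank (K := F), Nat.card_eq_fintype_card]
  have hinj {a b : ℕ} : Fintype.card F ^ a = Fintype.card F ^ b ↔ a = b :=
    Nat.pow_right_inj Fintype.one_lt_card
  set D := C ⊓ (sympForm F n).orthogonal C with hD
  have hle : C ≤ (sympForm F n).orthogonal D := le_orthogonal_inf_orthogonal C
  have hDp := finrank_orthogonal_sympForm_add D
  simp only [IsLinSubsysCode, IsSubsysCode, Submodule.coe_toAddSubgroup, sdual_coe,
    ← Submodule.coe_inf, ← hD]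
  have h1 : Nat.card C.toAddSubgroup = Fintype.card F ^ finrank F C := hcard C
  have h2 : Nat.card ((D : Set ((Fin n → F) × (Fin n → F)))) = Fintype.card F ^ finrank F D :=
    hcard D
  rw [h1, h2]
  simp only [← pow_add, hinj]
  refine and_congr_right fun hC => and_congr_right fun hD' => ?_
  have hk : k = 0 ↔ C = (sympForm F n).orthogonal D := by
    refine ⟨fun hk => Submodule.eq_of_le_of_finrank_eq hle (by omega), fun h => ?_⟩
    rw [← h] at hDp
    omega
  simp only [SetLike.coe_set_eq, ne_eq, hk]
  tauto

lemma minSwt_le {X : Set ((Fin n → F) × (Fin n → F))} {v} (hv : v ∈ X) (h0 : v ≠ 0) :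
    minSwt X ≤ swt v :=
  Nat.sInf_le ⟨v, ⟨hv, h0⟩, rfl⟩

lemma le_minSwt {X : Set ((Fin n → F) × (Fin n → F))} {e : ℕ} (hX : ∃ v ∈ X, v ≠ 0)
    (h : ∀ v ∈ X, v ≠ 0 → e ≤ swt v) : e ≤ minSwt X := by
  obtain ⟨v, hv, h0⟩ := hX
  refine le_csInf ⟨_, v, ⟨hv, h0⟩, rfl⟩ ?_
  rintro _ ⟨w, ⟨hw, hw0⟩, rfl⟩
  exact h w hw hw0

/-- Trading one subsystem dimension for one gauge dimension: the new code lies between `C`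
and the dual of the common radical. -/
lemma IsLinSubsysCode.exists_trade {p : ℕ} [Fact p.Prime] [Fintype F] [Algebra (ZMod p) F]
    {k r d : ℕ} {C : Submodule F ((Fin n → F) × (Fin n → F))}
    (h : IsLinSubsysCode p (k + 1) r d C) :
    ∃ C' Dp : Submodule F ((Fin n → F) × (Fin n → F)),
      C < C' ∧ C' ≤ Dp ∧ (∀ v ∈ Dp, v ∉ C → d ≤ swt v) ∧
      (k ≠ 0 → C' < Dp ∧
        IsLinSubsysCode p k (r + 1) (minSwt ((Dp : Set ((Fin n → F) × (Fin n → F))) \ C')) C') ∧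
      (k = 0 → d = minSwt ((Dp : Set ((Fin n → F) × (Fin n → F))) \ C) ∧
        IsLinSubsysCode p k (r + 1) (minSwt (Dp : Set ((Fin n → F) × (Fin n → F)))) C') := by
  obtain ⟨hC, hD, -, hd⟩ := isLinSubsysCode_iff.1 h
  specialize hd k.succ_ne_zero
  have hCo := finrank_orthogonal_sympForm_add C
  have hno : ¬ (sympForm F n).orthogonal C ≤ C := fun hle => by
    rw [inf_eq_right.2 hle] at hD
    omega
  obtain ⟨C', hCC', hfr, hrad⟩ :=
    exists_le_finrank_add_two_inf_orthogonal_eq sympForm_nondegenerate sympForm_isAlt hno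
  have hle : C' ≤ (sympForm F n).orthogonal (C ⊓ (sympForm F n).orthogonal C) :=
    hrad ▸ le_orthogonal_inf_orthogonal C'
  have hDp := finrank_orthogonal_sympForm_add (C ⊓ (sympForm F n).orthogonal C)
  refine ⟨C', _, lt_of_le_of_ne hCC' (by rintro rfl; omega), hle, fun v hv hvC => ?_,
    fun hk => ⟨lt_of_le_of_ne hle fun he => ?_, ?_⟩, fun hk => ⟨hd, ?_⟩⟩
  · rw [hd]
    exact minSwt_le ⟨hv, hvC⟩ fun h0 => hvC (h0 ▸ C.zero_mem)
  · rw [← he] at hDp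
    omega
  · rw [isLinSubsysCode_iff, hrad]
    exact ⟨by omega, by omega, fun h0 => absurd h0 hk, fun _ => rfl⟩
  · rw [isLinSubsysCode_iff, hrad]
    exact ⟨by omega, by omega,
      fun _ => ⟨Submodule.eq_of_le_of_finrank_eq hle (by omega), rfl⟩, fun h0 => absurd hk h0⟩

end Symplectic

/-- `F_q`-linear dimension trading: an `F_q`-linear `[[n,k,r,d]]_q` subsystem
code with `k > 1` pure to `d'` yields an `F_q`-linear `[[n,k-1,r+1,d_m]]_q` code with `d_m ≥ d`
pure to `min{d,d'}`; a pure `F_q`-linear `[[n,1,r,d]]_q` code yields an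
`F_q`-linear `[[n,0,r+1,d]]_q` code. -/
theorem stmt_1 (p m n : ℕ) [Fact p.Prime] (hm : 0 < m)
    (F : Type) [Field F] [Fintype F] [Algebra (ZMod p) F]
    (hq : Fintype.card F = p ^ m) (k r d d' : ℕ) :
    ((1 < k ∧ ∃ C : Submodule F ((Fin n → F) × (Fin n → F)),
        IsLinSubsysCode p k r d C ∧ d' ≤ minSwt (C : Set ((Fin n → F) × (Fin n → F)))) →
      ∃ dm, d ≤ dm ∧ ∃ C' : Submodule F ((Fin n → F) × (Fin n → F)),
        IsLinSubsysCode p (k - 1) (r + 1) dm C' ∧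
        min d d' ≤ minSwt (C' : Set ((Fin n → F) × (Fin n → F)))) ∧
    ((∃ C : Submodule F ((Fin n → F) × (Fin n → F)),
        IsLinSubsysCode p 1 r d C ∧ d ≤ minSwt (C : Set ((Fin n → F) × (Fin n → F)))) →
      ∃ C' : Submodule F ((Fin n → F) × (Fin n → F)),
        IsLinSubsysCode p 0 (r + 1) d C') := by
  constructor
  · rintro ⟨hk, C, hC, hpure⟩
    obtain ⟨k, rfl⟩ : ∃ j, k = j + 1 := ⟨k - 1, by omega⟩
    obtain ⟨C', Dp, hCC', hle, hd, hcode, -⟩ := hC.exists_trade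
    obtain ⟨hlt, hcode⟩ := hcode (by omega)
    refine ⟨_, ?_, C', hcode, ?_⟩
    · obtain ⟨v, hv, hvC⟩ := SetLike.exists_of_lt hlt
      exact le_minSwt ⟨v, ⟨hv, hvC⟩, fun h0 => hvC (h0 ▸ C'.zero_mem)⟩
        fun w hw _ => hd w hw.1 fun hwC => hw.2 (hCC'.le hwC)
    · obtain ⟨v, hv, hvC⟩ := SetLike.exists_of_lt hCC'
      refine le_minSwt ⟨v, hv, fun h0 => hvC (h0 ▸ C.zero_mem)⟩ fun w hw hw0 => ?_
      by_cases hwC : w ∈ C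
      · exact (min_le_right _ _).trans (hpure.trans (minSwt_le hwC hw0))
      · exact (min_le_left _ _).trans (hd w (hle hw) hwC)
  · rintro ⟨C, hC, hpure⟩
    obtain ⟨C', Dp, hCC', hle, hd, -, hcode⟩ := IsLinSubsysCode.exists_trade (k := 0) hC
    obtain ⟨hdC, hcode⟩ := hcode rfl
    obtain ⟨v, hv, hvC⟩ := SetLike.exists_of_lt (hCC'.trans_le hle)
    have hv0 : v ≠ 0 := fun h0 => hvC (h0 ▸ C.zero_mem)
    have hdp : d = minSwt (Dp : Set ((Fin n → F) × (Fin n → F))) := by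
      apply le_antisymm
      · refine le_minSwt ⟨v, hv, hv0⟩ fun w hw hw0 => ?_
        by_cases hwC : w ∈ C
        · exact hpure.trans (minSwt_le hwC hw0)
        · exact hd w hw hwC
      · rw [hdC]
        exact le_minSwt ⟨v, ⟨hv, hvC⟩, hv0⟩ fun w hw hw0 => minSwt_le hw.1 hw0
    exact ⟨C', hdp ▸ hcode⟩
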